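/- The Dirichlet maps are natural for surjective functions: for every surjective h : Fin n → Fin m and every α : Fin n → ℕ with α i ≥ 1 for all i, the pushforward measure of Dir_n(α) along the measurable map D(h) : Δ°_n → Δ°_m, D(h)(y)(j) = ∑_{i : h i = j} y i, equals Dir_m(M(h)(α)), where M(h)(α)(j) = ∑_{i : h i = j} α i; i.e. Measure.map (D(h)) (Dir_n(α)) = Dir_m(M(h)(α)). -/

import Mathlib

open MeasureTheory Finset

noncomputable section

/-- The open simplex `Δ°_n = {x : Fin n → ℝ | (∀ i, 0 < x i) ∧ ∑ i, x i = 1}`. -/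
def openSimplex (n : ℕ) : Set (Fin n → ℝ) := {x | (∀ i, 0 < x i) ∧ ∑ i, x i = 1}

/-- The open parameter domain for `Δ°_{m+1}`: the first `m` coordinates are
positive with sum `< 1`. -/
def simplexDomain (m : ℕ) : Set (Fin m → ℝ) := {y | (∀ i, 0 < y i) ∧ ∑ i, y i < 1}

/-- Parametrize the simplex `Δ°_{m+1}`: the last coordinate is `1 - ∑` of the others. -/
def toSimplex (m : ℕ) (y : Fin m → ℝ) : Fin (m + 1) → ℝ :=
  Fin.snoc y (1 - ∑ i, y i)

/-- The `m`-dimensional Lebesgue measure on the open simplex `Δ°_{m+1}`, obtained by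
pushing forward Lebesgue measure on the open parameter domain along the
parametrization in which the last coordinate is `1 - ∑` of the first `m`. -/
def simplexMeasure (m : ℕ) : Measure (Fin (m + 1) → ℝ) :=
  Measure.map (toSimplex m) (volume.restrict (simplexDomain m))

/-- The Dirichlet density `d(α)(x) = (Γ(∑ i, α i) / ∏ i, Γ(α i)) · ∏ i, (x i)^(α i − 1)`
with natural-number hyperparameters `α`. -/
def dirDensity {X : Type*} [Fintype X] (α : X → ℕ) (x : X → ℝ) : ℝ :=
  (Real.Gamma (∑ i, (α i : ℝ)) / ∏ i, Real.Gamma (α i : ℝ)) * ∏ i, x i ^ (α i - 1)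

/-- The Dirichlet distribution `Dir(α)` on `Δ°_{m+1}`, i.e. the measure with
density `d(α)` with respect to Lebesgue measure on the simplex. -/
def Dir (m : ℕ) (α : Fin (m + 1) → ℕ) : Measure (Fin (m + 1) → ℝ) :=
  (simplexMeasure m).withDensity fun x => ENNReal.ofReal (dirDensity α x)

/-- Pushforward of a multiset along `h`: `M(h)(α)(j) = ∑_{i : h i = j} α i`. -/
def mPush {n m : ℕ} (h : Fin n → Fin m) (α : Fin n → ℕ) : Fin m → ℕ :=
  fun j => ∑ i ∈ Finset.univ.filter (fun i => h i = j), α i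

/-- Pushforward of a point of the simplex along `h`: `D(h)(y)(j) = ∑_{i : h i = j} y i`. -/
def dPush {n m : ℕ} (h : Fin n → Fin m) (y : Fin n → ℝ) : Fin m → ℝ :=
  fun j => ∑ i ∈ Finset.univ.filter (fun i => h i = j), y i

/-- Tonelli's theorem for a product of functions of separate coordinates. -/
theorem lintegral_pi_prod {n : ℕ} (μ : Fin n → Measure ℝ) [∀ i, SigmaFinite (μ i)]
    (f : Fin n → ℝ → ENNReal) (hf : ∀ i, Measurable (f i)) :
    ∫⁻ x, ∏ i, f i (x i) ∂Measure.pi μ = ∏ i, ∫⁻ t, f i t ∂μ i := by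
  induction n with
  | zero => simp
  | succ n ih =>
    have hg : Measurable fun y : Fin n → ℝ => ∏ i, f (Fin.succAbove 0 i) (y i) := by fun_prop
    rw [← ((measurePreserving_piFinSuccAbove μ 0).symm _).lintegral_comp (by fun_prop),
      lintegral_prod _ (by fun_prop), Fin.prod_univ_succAbove _ 0]
    simp only [Fin.prod_univ_succAbove _ 0, MeasurableEquiv.piFinSuccAbove_symm_apply,
      Fin.insertNthEquiv_apply, Fin.insertNth_apply_same, Fin.insertNth_apply_succAbove]
    simp_rw [lintegral_const_mul _ hg]
    rw [lintegral_mul_const _ (hf 0), ih _ _ fun i => hf _]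

/-- A product of measures with densities has the product density. -/
theorem pi_withDensity_volume {n : ℕ} (f : Fin n → ℝ → ENNReal) (hf : ∀ i, Measurable (f i))
    [∀ i, SigmaFinite (volume.withDensity (f i))] :
    Measure.pi (fun i => volume.withDensity (f i)) =
      volume.withDensity fun x : Fin n → ℝ => ∏ i, f i (x i) := by
  refine Measure.pi_eq fun s hs => ?_
  rw [withDensity_apply _ (MeasurableSet.univ_pi hs), volume_pi, Measure.restrict_pi_pi,
    lintegral_pi_prod _ _ hf]
  exact Finset.prod_congr rfl fun i _ => (withDensity_apply _ (hs i)).symm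

theorem lintegral_eq_pow_mul_lintegral_smul {n : ℕ} {s : ℝ} (hs : 0 < s)
    {g : (Fin n → ℝ) → ENNReal} (hg : Measurable g) :
    ∫⁻ y, g y = ENNReal.ofReal (s ^ n) * ∫⁻ y, g (s • y) := by
  have hpos : 0 < s ^ n := pow_pos hs n
  have key := lintegral_map (μ := volume) hg (measurable_const_smul (α := Fin n → ℝ) s)
  rw [Measure.map_addHaar_smul _ hs.ne', lintegral_smul_measure] at key
  rw [← key, smul_eq_mul, ← mul_assoc, ← ENNReal.ofReal_mul hpos.le, Module.finrank_fin_fun,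
    abs_of_pos (inv_pos.2 hpos), mul_inv_cancel₀ hpos.ne', ENNReal.ofReal_one, one_mul]

theorem measurable_toSimplex (n : ℕ) : Measurable (toSimplex n) := by
  refine measurable_pi_lambda _ fun i => ?_
  induction i using Fin.lastCases with
  | last => simp only [toSimplex, Fin.snoc_last]; fun_prop
  | cast i => simp only [toSimplex, Fin.snoc_castSucc]; fun_prop

theorem sum_toSimplex (n : ℕ) (y : Fin n → ℝ) : ∑ i, toSimplex n y i = 1 := by
  simp [toSimplex, Fin.sum_univ_castSucc]

theorem toSimplex_pos_iff {n : ℕ} {y : Fin n → ℝ} :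
    (∀ i, 0 < toSimplex n y i) ↔ y ∈ simplexDomain n := by
  simp [Fin.forall_fin_succ', toSimplex, simplexDomain]

theorem measurableSet_simplexDomain (n : ℕ) : MeasurableSet (simplexDomain n) := by
  unfold simplexDomain
  measurability

/-- Integration over `ℝ^(n+1)` in the coordinates `(s, y)` given by `x = s • toSimplex n y`. -/
theorem lintegral_eq_lintegral_smul_toSimplex {n : ℕ} {Φ : (Fin (n + 1) → ℝ) → ENNReal}
    (hΦ : Measurable Φ) (h0 : ∀ x, ∑ i, x i ≤ 0 → Φ x = 0) :
    ∫⁻ x, Φ x = ∫⁻ s in Set.Ioi (0 : ℝ),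
      ENNReal.ofReal (s ^ n) * ∫⁻ y, Φ (s • toSimplex n y) := by
  have hsnoc : Measurable fun p : (Fin n → ℝ) × ℝ =>
      (Fin.snoc p.1 (p.2 - ∑ i, p.1 i) : Fin (n + 1) → ℝ) := by
    refine measurable_pi_lambda _ fun i => ?_
    induction i using Fin.lastCases with
    | last => simp only [Fin.snoc_last]; fun_prop
    | cast i => simp only [Fin.snoc_castSucc]; fun_prop
  have hsum : ∀ (y : Fin n → ℝ) (s : ℝ),
      ∑ i, (Fin.snoc y (s - ∑ i, y i) : Fin (n + 1) → ℝ) i = s := fun y s => by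
    simp [Fin.sum_univ_castSucc]
  calc ∫⁻ x, Φ x
      = ∫⁻ y : Fin n → ℝ, ∫⁻ t : ℝ, Φ (Fin.snoc y t) := by
        rw [← ((volume_preserving_piFinSuccAbove (fun _ => ℝ) (Fin.last n)).symm _).lintegral_comp
          hΦ, Measure.volume_eq_prod, lintegral_prod_symm _ (by fun_prop)]
        simp [MeasurableEquiv.piFinSuccAbove_symm_apply, Fin.snocEquiv]
    _ = ∫⁻ y : Fin n → ℝ, ∫⁻ s : ℝ, Φ (Fin.snoc y (s - ∑ i, y i)) := by
        refine lintegral_congr fun y => ?_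
        exact (lintegral_sub_right_eq_self (fun t => Φ (Fin.snoc y t)) _).symm
    _ = ∫⁻ s : ℝ, ∫⁻ y : Fin n → ℝ, Φ (Fin.snoc y (s - ∑ i, y i)) :=
        lintegral_lintegral_swap (hΦ.comp hsnoc).aemeasurable
    _ = ∫⁻ s in Set.Ioi (0 : ℝ), ∫⁻ y : Fin n → ℝ, Φ (Fin.snoc y (s - ∑ i, y i)) := by
        refine (setLIntegral_eq_of_support_subset fun s hs => ?_).symm
        by_contra hs'
        refine hs ?_
        simp [h0 _ ((hsum _ _).trans_le (not_lt.1 hs'))]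
    _ = _ := by
        refine setLIntegral_congr_fun measurableSet_Ioi fun s hs => ?_
        have hm : Measurable fun y : Fin n → ℝ =>
            Φ (Fin.snoc y (s - ∑ i, y i)) := hΦ.comp (hsnoc.comp measurable_prodMk_right)
        rw [lintegral_eq_pow_mul_lintegral_smul hs hm]
        congr 1
        refine lintegral_congr fun y => congrArg Φ ?_
        ext i
        induction i using Fin.lastCases with
        | last => simp [toSimplex, mul_sub, Finset.mul_sum]
        | cast i => simp [toSimplex]

/-- The density of the gamma distribution with integer shape `a` and unit rate. -/
def gammaDensity (a : ℕ) (x : ℝ) : ENNReal :=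
  (Set.Ioi (0 : ℝ)).indicator
    (fun x => ENNReal.ofReal (x ^ (a - 1) * Real.exp (-x) / Real.Gamma a)) x

/-- The gamma distribution with integer shape `a` and unit rate. -/
def gammaLaw (a : ℕ) : Measure ℝ := volume.withDensity (gammaDensity a)

theorem measurable_gammaDensity (a : ℕ) : Measurable (gammaDensity a) :=
  Measurable.indicator (by fun_prop) measurableSet_Ioi

theorem isProbabilityMeasure_gammaLaw {a : ℕ} (ha : 1 ≤ a) :
    IsProbabilityMeasure (gammaLaw a) := by
  have ha' : (0 : ℝ) < a := by exact_mod_cast ha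
  have hΓ := Real.Gamma_pos_of_pos ha'
  have heq : Set.EqOn (fun x : ℝ => Real.exp (-x) * x ^ ((a : ℝ) - 1))
      (fun x : ℝ => x ^ (a - 1) * Real.exp (-x)) (Set.Ioi 0) := fun x _ => by
    dsimp only
    rw [← Nat.cast_one, ← Nat.cast_sub ha, Real.rpow_natCast, mul_comm]
  have hint := (Real.GammaIntegral_convergent ha').congr_fun heq measurableSet_Ioi
  constructor
  rw [gammaLaw, withDensity_apply _ MeasurableSet.univ, Measure.restrict_univ]
  change ∫⁻ x, (Set.Ioi (0 : ℝ)).indicator _ x = 1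
  rw [lintegral_indicator measurableSet_Ioi, ← ofReal_integral_eq_lintegral_ofReal
    (hint.div_const _)
    ((ae_restrict_mem measurableSet_Ioi).mono fun x hx => by
      have : (0 : ℝ) < x := hx
      simp only [Pi.zero_apply]; positivity),
    integral_div, ← setIntegral_congr_fun measurableSet_Ioi heq, ← Real.Gamma_eq_integral ha',
    div_self hΓ.ne', ENNReal.ofReal_one]

theorem sigmaFinite_gammaLaw (a : ℕ) : SigmaFinite (gammaLaw a) := by
  refine SigmaFinite.withDensity_of_ne_top ?_
  refine Filter.Eventually.of_forall fun x => ?_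
  unfold gammaDensity Set.indicator
  split_ifs <;> simp

theorem lintegral_Dir {n : ℕ} (α : Fin (n + 1) → ℕ) {f : (Fin (n + 1) → ℝ) → ENNReal}
    (hf : Measurable f) :
    ∫⁻ x, f x ∂Dir n α = ∫⁻ y in simplexDomain n,
      ENNReal.ofReal (dirDensity α (toSimplex n y)) * f (toSimplex n y) := by
  have hd : Measurable fun x : Fin (n + 1) → ℝ => ENNReal.ofReal (dirDensity α x) := by
    unfold dirDensity
    fun_prop
  rw [Dir, lintegral_withDensity_eq_lintegral_mul _ hd hf, simplexMeasure,
    lintegral_map (hd.mul hf) (measurable_toSimplex n)]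
  rfl

/-- In the coordinates `x = s • toSimplex n y`, the joint gamma density factors into a gamma
density in `s` and a Dirichlet density in `y`. -/
theorem pow_mul_prod_gammaDensity {n : ℕ} {α : Fin (n + 1) → ℕ} (hα : ∀ i, 1 ≤ α i)
    {s : ℝ} (hs : 0 < s) (y : Fin n → ℝ) :
    ENNReal.ofReal (s ^ n) * ∏ i, gammaDensity (α i) (s * toSimplex n y i) =
      gammaDensity (∑ i, α i) s *
        (simplexDomain n).indicator (fun y => ENNReal.ofReal (dirDensity α (toSimplex n y))) y := by
  by_cases hy : y ∈ simplexDomain n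
  · have hpos := toSimplex_pos_iff.2 hy
    have hΓ : ∀ i, 0 < Real.Gamma (α i) := fun i =>
      Real.Gamma_pos_of_pos (by exact_mod_cast hα i)
    have hA : n + ∑ i, (α i - 1) = ∑ i, α i - 1 := by
      have h1 : ∑ i, α i = ∑ i, (α i - 1) + ∑ _i : Fin (n + 1), 1 := by
        rw [← Finset.sum_add_distrib]
        exact Finset.sum_congr rfl fun i _ => (Nat.sub_add_cancel (hα i)).symm
      simp at h1
      omega
    have hA0 : (0 : ℝ) < ∑ i, (α i : ℝ) :=
      Finset.sum_pos (fun i _ => by exact_mod_cast hα i) Finset.univ_nonempty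
    have hΓA := Real.Gamma_pos_of_pos hA0
    have hprod : ∀ i, gammaDensity (α i) (s * toSimplex n y i) = ENNReal.ofReal
        ((s * toSimplex n y i) ^ (α i - 1) * Real.exp (-(s * toSimplex n y i)) /
          Real.Gamma (α i)) := fun i =>
      Set.indicator_of_mem (show (s * toSimplex n y i) ∈ Set.Ioi 0 from mul_pos hs (hpos i)) _
    have hs' : gammaDensity (∑ i, α i) s = ENNReal.ofReal
        (s ^ (∑ i, α i - 1) * Real.exp (-s) / Real.Gamma (∑ i, (α i : ℝ))) := by
      rw [← Nat.cast_sum]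
      exact Set.indicator_of_mem (show s ∈ Set.Ioi 0 from hs) _
    rw [Set.indicator_of_mem hy, hs', Finset.prod_congr rfl fun i _ => hprod i,
      ← ENNReal.ofReal_prod_of_nonneg, ← ENNReal.ofReal_mul (by positivity),
      ← ENNReal.ofReal_mul (by positivity)]
    · congr 1
      simp only [mul_pow, Finset.prod_div_distrib, Finset.prod_mul_distrib, Finset.prod_pow_eq_pow_sum,
        ← Real.exp_sum, Finset.sum_neg_distrib, ← Finset.mul_sum, sum_toSimplex, mul_one,
        dirDensity, ← hA, pow_add]
      have hΓp : ∏ i, Real.Gamma (α i) ≠ 0 := Finset.prod_ne_zero_iff.2 fun i _ => (hΓ i).ne'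
      field_simp
    · intro i _
      have := hΓ i
      have := hpos i
      positivity
  · rw [Set.indicator_of_notMem hy, mul_zero]
    rw [← toSimplex_pos_iff] at hy
    push Not at hy
    obtain ⟨i, hi⟩ := hy
    rw [Finset.prod_eq_zero (Finset.mem_univ i), mul_zero]
    exact Set.indicator_of_notMem
      (show ¬ 0 < s * toSimplex n y i from (mul_nonpos_of_nonneg_of_nonpos hs.le hi).not_gt) _

/-- For independent gamma variables, the total is gamma distributed and independent of the
normalized vector, which is Dirichlet distributed. -/
theorem lintegral_pi_gammaLaw {n : ℕ} {α : Fin (n + 1) → ℕ} (hα : ∀ i, 1 ≤ α i)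
    {f : ℝ → ENNReal} (hf : Measurable f) {g : (Fin (n + 1) → ℝ) → ENNReal} (hg : Measurable g) :
    ∫⁻ x, f (∑ i, x i) * g ((∑ i, x i)⁻¹ • x) ∂Measure.pi (fun i => gammaLaw (α i)) =
      (∫⁻ s, f s ∂gammaLaw (∑ i, α i)) * ∫⁻ x, g x ∂Dir n α := by
  have := fun i => sigmaFinite_gammaLaw (α i)
  have hp : Measurable fun x : Fin (n + 1) → ℝ => ∏ i, gammaDensity (α i) (x i) :=
    Finset.measurable_prod _ fun i _ => (measurable_gammaDensity _).comp (measurable_pi_apply i)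
  have hfg : Measurable fun x : Fin (n + 1) → ℝ => f (∑ i, x i) * g ((∑ i, x i)⁻¹ • x) := by
    fun_prop
  have hpi : Measure.pi (fun i => gammaLaw (α i)) =
      volume.withDensity fun x : Fin (n + 1) → ℝ => ∏ i, gammaDensity (α i) (x i) :=
    @pi_withDensity_volume _ (fun i => gammaDensity (α i))
      (fun i => measurable_gammaDensity (α i)) this
  have hd : Measurable fun y : Fin n → ℝ =>
      ENNReal.ofReal (dirDensity α (toSimplex n y)) * g (toSimplex n y) := by
    have := measurable_toSimplex n
    unfold dirDensity
    fun_prop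
  rw [hpi, lintegral_withDensity_eq_lintegral_mul _ hp hfg,
    lintegral_eq_lintegral_smul_toSimplex (hp.mul hfg), lintegral_Dir α hg, gammaLaw,
    lintegral_withDensity_eq_lintegral_mul _ (measurable_gammaDensity _) hf,
    ← lintegral_mul_const _ ((measurable_gammaDensity _).mul hf)]
  · rw [← setLIntegral_eq_of_support_subset (μ := volume) (s := Set.Ioi (0 : ℝ))]
    · refine setLIntegral_congr_fun measurableSet_Ioi fun s hs => ?_
      have hs0 : s ≠ 0 := ne_of_gt hs
      dsimp only [Pi.mul_apply]
      rw [← lintegral_const_mul' _ _ ENNReal.ofReal_ne_top,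
        ← lintegral_indicator (measurableSet_simplexDomain n),
        ← lintegral_const_mul _ (hd.indicator (measurableSet_simplexDomain n))]
      refine lintegral_congr fun y => ?_
      have hsum : ∑ i, (s • toSimplex n y) i = s := by
        simp [← Finset.mul_sum, sum_toSimplex]
      rw [hsum, smul_smul, inv_mul_cancel₀ hs0, one_smul, ← mul_assoc]
      simp only [Pi.smul_apply, smul_eq_mul]
      rw [pow_mul_prod_gammaDensity hα hs, Set.indicator_mul_left]
      ring
    · intro s hs
      by_contra hs'
      refine hs ?_
      simp [gammaDensity, Set.indicator_of_notMem hs']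
  · intro x hx
    obtain ⟨i, -, hi⟩ : ∃ i ∈ Finset.univ, x i ≤ 0 := by
      by_contra! hcon
      exact hx.not_gt (Finset.sum_pos hcon Finset.univ_nonempty)
    have : gammaDensity (α i) (x i) = 0 :=
      Set.indicator_of_notMem (show ¬ 0 < x i from hi.not_gt) _
    simp [Finset.prod_eq_zero (f := fun i => gammaDensity (α i) (x i)) (Finset.mem_univ i) this]

theorem isProbabilityMeasure_Dir {n : ℕ} {α : Fin (n + 1) → ℕ} (hα : ∀ i, 1 ≤ α i) :
    IsProbabilityMeasure (Dir n α) := by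
  have := fun i => isProbabilityMeasure_gammaLaw (hα i)
  have := isProbabilityMeasure_gammaLaw ((hα 0).trans
    (Finset.single_le_sum (fun i _ => Nat.zero_le (α i)) (Finset.mem_univ 0)))
  have key := lintegral_pi_gammaLaw hα (f := 1) measurable_one (g := 1) measurable_one
  exact ⟨by simpa using key.symm⟩

/-- The normalization of a vector of independent gamma variables is Dirichlet distributed. -/
theorem map_normalize_pi_gammaLaw {n : ℕ} {α : Fin (n + 1) → ℕ} (hα : ∀ i, 1 ≤ α i) :
    Measure.map (fun x => (∑ i, x i)⁻¹ • x) (Measure.pi fun i => gammaLaw (α i)) = Dir n α := by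
  have := isProbabilityMeasure_gammaLaw ((hα 0).trans
    (Finset.single_le_sum (fun i _ => Nat.zero_le (α i)) (Finset.mem_univ 0)))
  refine Measure.ext_of_lintegral _ fun g hg => ?_
  have key := lintegral_pi_gammaLaw hα (f := 1) measurable_one hg
  rw [lintegral_map hg (by fun_prop)]
  simpa using key

/-- The sum of independent gamma variables is gamma distributed. -/
theorem map_sum_pi_gammaLaw {ι : Type*} [Fintype ι] [Nonempty ι] {α : ι → ℕ}
    (hα : ∀ i, 1 ≤ α i) :
    Measure.map (fun x => ∑ i, x i) (Measure.pi fun i => gammaLaw (α i)) =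
      gammaLaw (∑ i, α i) := by
  obtain ⟨k, hk⟩ := Nat.exists_eq_succ_of_ne_zero (Fintype.card_ne_zero (α := ι))
  let e : Fin (k + 1) ≃ ι := (Fintype.equivFinOfCardEq hk).symm
  have := fun i => sigmaFinite_gammaLaw (α i)
  have := isProbabilityMeasure_Dir (α := fun i => α (e i)) fun i => hα _
  refine Measure.ext_of_lintegral _ fun f hf => ?_
  have key := lintegral_pi_gammaLaw (α := fun i => α (e i)) (fun i => hα _) hf
    (g := 1) measurable_one
  have hmp := measurePreserving_piCongrLeft (fun i => gammaLaw (α i)) e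
  rw [lintegral_map hf (by fun_prop), ← hmp.lintegral_comp (by fun_prop), ← e.sum_comp α]
  have hsum : ∀ x : Fin (k + 1) → ℝ,
      ∑ i, MeasurableEquiv.piCongrLeft (fun _ : ι => ℝ) e x i = ∑ i, x i := fun x => by
    rw [← e.sum_comp]
    simp [MeasurableEquiv.coe_piCongrLeft]
  simp_rw [hsum]
  simpa using key

/-- Product measures can be regrouped along the fibers of a map of index sets. -/
theorem map_pi_fiber {ι κ : Type*} [Fintype ι] [Fintype κ] [DecidableEq κ] (h : ι → κ)
    (μ : ι → Measure ℝ) [∀ i, SigmaFinite (μ i)] :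
    Measure.map (fun (z : (j : κ) → {i // h i = j} → ℝ) i => z (h i) ⟨i, rfl⟩)
      (Measure.pi fun j => Measure.pi fun i : {i // h i = j} => μ i) = Measure.pi μ := by
  refine (Measure.pi_eq fun s hs => ?_).symm
  rw [Measure.map_apply (by fun_prop) (MeasurableSet.univ_pi hs)]
  have hpre : (fun (z : (j : κ) → {i // h i = j} → ℝ) i => z (h i) ⟨i, rfl⟩) ⁻¹' Set.univ.pi s =
      Set.univ.pi fun j => Set.univ.pi fun i : {i // h i = j} => s i := by
    ext z
    simp only [Set.mem_preimage, Set.mem_univ_pi, Subtype.forall]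
    exact ⟨fun hz j i hi => hi ▸ hz i, fun hz i => hz _ i rfl⟩
  rw [hpre, Measure.pi_pi]
  simp_rw [Measure.pi_pi]
  exact Fintype.prod_fiberwise h fun i => μ i (s i)

theorem measurable_dPush {n m : ℕ} (h : Fin n → Fin m) : Measurable (dPush h) := by
  unfold dPush
  fun_prop

theorem sum_dPush {n m : ℕ} (h : Fin n → Fin m) (x : Fin n → ℝ) :
    ∑ j, dPush h x j = ∑ i, x i :=
  Finset.sum_fiberwise _ _ _

theorem dPush_smul {n m : ℕ} (h : Fin n → Fin m) (c : ℝ) (x : Fin n → ℝ) :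
    dPush h (c • x) = c • dPush h x := by
  ext j
  simp [dPush, Finset.mul_sum]

theorem map_dPush_pi_gammaLaw {n m : ℕ} {h : Fin n → Fin m} (hsurj : Function.Surjective h)
    {α : Fin n → ℕ} (hα : ∀ i, 1 ≤ α i) :
    Measure.map (dPush h) (Measure.pi fun i => gammaLaw (α i)) =
      Measure.pi fun j => gammaLaw (mPush h α j) := by
  have := fun i => isProbabilityMeasure_gammaLaw (hα i)
  have hne : ∀ j, Nonempty {i // h i = j} := fun j => nonempty_subtype.2 (hsurj j)
  have hlaw : ∀ j, Measure.map (fun x => ∑ i, x i)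
      (Measure.pi fun i : {i // h i = j} => gammaLaw (α i)) = gammaLaw (mPush h α j) := fun j => by
    rw [map_sum_pi_gammaLaw fun i : {i // h i = j} => hα i, mPush,
      Finset.sum_subtype (p := fun i => h i = j) _ (by simp)]
  have hcomp : dPush h ∘ (fun (z : (j : Fin m) → {i // h i = j} → ℝ) i => z (h i) ⟨i, rfl⟩) =
      fun z j => ∑ i, z j i := by
    ext z j
    simp only [Function.comp_apply, dPush]
    rw [Finset.sum_subtype (p := fun i => h i = j) _ (by simp)]
    refine Finset.sum_congr rfl ?_
    rintro ⟨i, rfl⟩ -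
    rfl
  rw [← map_pi_fiber h, Measure.map_map (measurable_dPush h) (by fun_prop), hcomp]
  simp_rw [← hlaw]
  exact Measure.pi_map_pi fun j => by fun_prop

/-- **The Dirichlet maps are natural for surjective functions.** For every
surjective `h : Fin n → Fin m` (with `n, m ≥ 1`) and every `α : Fin n → ℕ` with
`α i ≥ 1` for all `i`, the pushforward of `Dir_n(α)` along the measurable map
`D(h) : y ↦ (j ↦ ∑_{i : h i = j} y i)` equals `Dir_m(M(h)(α))`. -/
theorem dirichlet_natural (n m : ℕ) (h : Fin (n + 1) → Fin (m + 1))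
    (hsurj : Function.Surjective h) (α : Fin (n + 1) → ℕ) (hα : ∀ i, 1 ≤ α i) :
    Measure.map (dPush h) (Dir n α) = Dir m (mPush h α) := by
  have hα' : ∀ j, 1 ≤ mPush h α j := fun j => by
    obtain ⟨i, hi⟩ := hsurj j
    exact (hα i).trans (Finset.single_le_sum (f := α) (fun i _ => Nat.zero_le _) (by simp [hi]))
  have hnorm : Measurable fun x : Fin (n + 1) → ℝ => (∑ i, x i)⁻¹ • x := by fun_prop
  have hnorm' : Measurable fun x : Fin (m + 1) → ℝ => (∑ i, x i)⁻¹ • x := by fun_prop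
  have hcomm : dPush h ∘ (fun x => (∑ i, x i)⁻¹ • x) =
      (fun x => (∑ i, x i)⁻¹ • x) ∘ dPush h := by
    ext1 x
    simp only [Function.comp_apply, dPush_smul, sum_dPush]
  rw [← map_normalize_pi_gammaLaw hα, ← map_normalize_pi_gammaLaw hα',
    Measure.map_map (measurable_dPush h) hnorm, hcomm,
    ← Measure.map_map hnorm' (measurable_dPush h), map_dPush_pi_gammaLaw hsurj hα]
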